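/- arXiv:0806.4967 — 2 statements merged into one kernel-verified Lean document; each statement's English description precedes it below -/
import Mathlib

section
/- Set N₁ = E₂₃, N₂ = E₁₂ − E₃₄, N₃ = E₁₂ + E₂₃ − E₃₄ in M₄(ℂ). Every nonzero nilpotent element X of gsp₄(ℂ) is GSp₄(ℂ)-conjugate to exactly one of N₁, N₂, N₃: there exist g ∈ GL₄(ℂ) with gᵀJg = cJ for some c ∈ ℂ^× and a unique index i ∈ {1, 2, 3} such that g X g⁻¹ = Nᵢ. -/
open Matrix
open scoped Matrix

noncomputable section

/-- The antidiagonal symplectic form on `ℂ⁴`. -/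
def J4 : Matrix (Fin 4) (Fin 4) ℂ :=
  !![0, 0, 0, 1; 0, 0, 1, 0; 0, -1, 0, 0; -1, 0, 0, 0]

/-- The representatives `𝒩₁ = E₂₃`, `𝒩₂ = E₁₂ − E₃₄`, `𝒩₃ = E₁₂ + E₂₃ − E₃₄` of the
nonzero nilpotent `GSp₄(ℂ)`-conjugacy classes in `gsp₄(ℂ)`. -/
def Nrep : Fin 3 → Matrix (Fin 4) (Fin 4) ℂ :=
  ![!![0, 0, 0, 0; 0, 0, 1, 0; 0, 0, 0, 0; 0, 0, 0, 0],
    !![0, 1, 0, 0; 0, 0, 0, 0; 0, 0, 0, -1; 0, 0, 0, 0],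
    !![0, 1, 0, 0; 0, 0, 1, 0; 0, 0, 0, -1; 0, 0, 0, 0]]

/-- The symplectic form on `ℂ⁴` with Gram matrix `J4`. -/
def sympForm : LinearMap.BilinForm ℂ (Fin 4 → ℂ) := Matrix.toBilin' J4

theorem sympForm_apply (x y : Fin 4 → ℂ) :
    sympForm x y = x 0 * y 3 + x 1 * y 2 - x 2 * y 1 - x 3 * y 0 := by
  simp [sympForm, Matrix.toBilin'_apply, J4, Fin.sum_univ_four]
  ring

theorem sympForm_swap (x y : Fin 4 → ℂ) : sympForm x y = -sympForm y x := by
  simp only [sympForm_apply]; ring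

theorem sympForm_self (x : Fin 4 → ℂ) : sympForm x x = 0 := by
  simp only [sympForm_apply]; ring

theorem exists_sympForm_ne_zero {x : Fin 4 → ℂ} (hx : x ≠ 0) : ∃ y, sympForm x y ≠ 0 := by
  by_contra! h
  apply hx
  ext i
  fin_cases i
  · simpa [sympForm_apply] using h ![0, 0, 0, 1]
  · simpa [sympForm_apply] using h ![0, 0, 1, 0]
  · simpa [sympForm_apply] using h ![0, 1, 0, 0]
  · simpa [sympForm_apply] using h ![1, 0, 0, 0]

/-- The vectors `h` form a basis whose Gram matrix for the symplectic form is `c • J4`. -/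
def IsSympFrame (c : ℂ) (h : Fin 4 → Fin 4 → ℂ) : Prop :=
  c ≠ 0 ∧ ∀ i j, sympForm (h i) (h j) = c * J4 i j

theorem isSympFrame_mk {c : ℂ} {a₁ a₂ a₃ a₄ : Fin 4 → ℂ} (hc : c ≠ 0)
    (h₁₂ : sympForm a₁ a₂ = 0) (h₁₃ : sympForm a₁ a₃ = 0) (h₁₄ : sympForm a₁ a₄ = c)
    (h₂₃ : sympForm a₂ a₃ = c) (h₂₄ : sympForm a₂ a₄ = 0) (h₃₄ : sympForm a₃ a₄ = 0) :
    IsSympFrame c ![a₁, a₂, a₃, a₄] := by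
  refine ⟨hc, ?_⟩
  simp [Fin.forall_fin_succ, J4, sympForm_self, h₁₂, h₁₃, h₁₄, h₂₃, h₂₄, h₃₄,
    sympForm_swap a₂ a₁, sympForm_swap a₃ a₁, sympForm_swap a₄ a₁, sympForm_swap a₃ a₂,
    sympForm_swap a₄ a₂, sympForm_swap a₄ a₃]

namespace IsSympFrame

variable {c : ℂ} {h : Fin 4 → Fin 4 → ℂ}

theorem mul_J4_mul_transpose (hh : IsSympFrame c h) :
    (Matrix.of h) * J4 * (Matrix.of h)ᵀ = c • J4 := by
  ext i j
  rw [Matrix.smul_apply, smul_eq_mul, ← hh.2 i j, sympForm_apply]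
  simp [Matrix.mul_apply, Fin.sum_univ_four, J4]
  ring

theorem isUnit (hh : IsSympFrame c h) : IsUnit (Matrix.of h)ᵀ := by
  have h1 := congrArg Matrix.det hh.mul_J4_mul_transpose
  have hJ : J4.det = 1 := by
    simp [J4, Matrix.det_succ_row_zero, Fin.sum_univ_succ, Fin.succAbove]
    norm_num
  rw [Matrix.isUnit_iff_isUnit_det, isUnit_iff_ne_zero]
  intro h0
  simp [h0, hJ] at h1
  exact hh.1 (pow_eq_zero_iff four_ne_zero |>.1 h1.symm)

theorem exists_eq_sum (hh : IsSympFrame c h) (x : Fin 4 → ℂ) :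
    ∃ a : Fin 4 → ℂ, x = ∑ i, a i • h i := by
  obtain ⟨a, ha⟩ := (Matrix.mulVec_surjective_iff_isUnit.2 hh.isUnit) x
  refine ⟨a, ?_⟩
  rw [← ha]
  ext j
  simp [Matrix.mulVec, dotProduct, mul_comm]

/-- A symplectic frame in which `X` acts by the matrix `N` conjugates `X` to `N`. -/
theorem exists_conj (hh : IsSympFrame c h) {X N : Matrix (Fin 4) (Fin 4) ℂ}
    (hN : ∀ j, Matrix.toLin' X (h j) = ∑ i, N i j • h i) :
    ∃ (g : GL (Fin 4) ℂ) (d : ℂˣ),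
      (g : Matrix (Fin 4) (Fin 4) ℂ)ᵀ * J4 * (g : Matrix (Fin 4) (Fin 4) ℂ) = (d : ℂ) • J4 ∧
      (g : Matrix (Fin 4) (Fin 4) ℂ) * X * (↑g⁻¹ : Matrix (Fin 4) (Fin 4) ℂ) = N := by
  obtain ⟨m, hm⟩ := hh.isUnit
  have hXm : X * m = m * N := by
    ext i j
    have := congrFun (hN j) i
    simpa [hm, Matrix.mul_apply, Matrix.mulVec, dotProduct, mul_comm] using this
  have hJ : (m : Matrix (Fin 4) (Fin 4) ℂ)ᵀ * J4 * m = c • J4 := by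
    rw [hm, Matrix.transpose_transpose]
    exact hh.mul_J4_mul_transpose
  have hinv : (m : Matrix (Fin 4) (Fin 4) ℂ) * (↑m⁻¹ : Matrix (Fin 4) (Fin 4) ℂ) = 1 := by
    simp
  have hinv' : (↑m⁻¹ : Matrix (Fin 4) (Fin 4) ℂ)ᵀ * (m : Matrix (Fin 4) (Fin 4) ℂ)ᵀ = 1 := by
    rw [← Matrix.transpose_mul, hinv, Matrix.transpose_one]
  refine ⟨m⁻¹, (Units.mk0 c hh.1)⁻¹, ?_, ?_⟩
  · have : J4 = c • ((↑m⁻¹ : Matrix (Fin 4) (Fin 4) ℂ)ᵀ * J4 *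
        (↑m⁻¹ : Matrix (Fin 4) (Fin 4) ℂ)) := by
      calc J4 = ((↑m⁻¹ : Matrix (Fin 4) (Fin 4) ℂ)ᵀ * (m : Matrix (Fin 4) (Fin 4) ℂ)ᵀ) * J4 *
            ((m : Matrix (Fin 4) (Fin 4) ℂ) * (↑m⁻¹ : Matrix (Fin 4) (Fin 4) ℂ)) := by
              rw [hinv, hinv', one_mul, mul_one]
        _ = (↑m⁻¹ : Matrix (Fin 4) (Fin 4) ℂ)ᵀ *
            ((m : Matrix (Fin 4) (Fin 4) ℂ)ᵀ * J4 * m) *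
            (↑m⁻¹ : Matrix (Fin 4) (Fin 4) ℂ) := by simp only [mul_assoc]
        _ = _ := by rw [hJ, Matrix.mul_smul, Matrix.smul_mul]
    rw [Units.val_inv_eq_inv_val, Units.val_mk0, eq_inv_smul_iff₀ hh.1, ← this]
  · rw [inv_inv, mul_assoc, hXm, ← mul_assoc]
    simp

end IsSympFrame

/-- Polarization: a nonzero symmetric form has a non-isotropic vector. -/
theorem exists_diag_ne_zero {S : Set (Fin 4 → ℂ)} {T : Module.End ℂ (Fin 4 → ℂ)}
    (hS : ∀ x ∈ S, ∀ y ∈ S, x + y ∈ S)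
    (hT : ∀ x y, sympForm x (T y) = sympForm y (T x)) {x y : Fin 4 → ℂ} (hx : x ∈ S) (hy : y ∈ S)
    (hxy : sympForm x (T y) ≠ 0) : ∃ z ∈ S, sympForm z (T z) ≠ 0 := by
  by_contra! h
  have h1 := h _ (hS x hx y hy)
  simp only [map_add, LinearMap.add_apply, h x hx, h y hy, hT y x] at h1
  apply hxy
  linear_combination h1 / 2

section Nilpotent

variable {T : Module.End ℂ (Fin 4 → ℂ)}

theorem exists_frame_of_cube_ne_zero
    (hT : ∀ x y, sympForm (T x) y = -sympForm x (T y)) (h4 : ∀ x, T (T (T (T x))) = 0)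
    (h3 : ∃ x, T (T (T x)) ≠ 0) :
    ∃ c h, IsSympFrame c h ∧ ∀ j, T (h j) = ∑ i, Nrep 2 i j • h i := by
  obtain ⟨x, hx⟩ := h3
  obtain ⟨y, hy⟩ := exists_sympForm_ne_zero hx
  obtain ⟨v, -, hv⟩ := exists_diag_ne_zero (S := Set.univ) (T := T ^ 3) (by simp)
    (fun x y => by simp [pow_succ, sympForm_swap y, hT]) (Set.mem_univ y) (Set.mem_univ x)
    (by rw [sympForm_swap]; simpa [pow_succ] using hy)
  replace hv : sympForm v (T (T (T v))) ≠ 0 := by simpa [pow_succ] using hv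
  obtain ⟨u, hu, hu1⟩ : ∃ u, sympForm u (T (T (T u))) ≠ 0 ∧ sympForm u (T u) = 0 := by
    refine ⟨v + (-(sympForm v (T v)) / (2 * sympForm v (T (T (T v))))) • T (T v), ?_, ?_⟩
    · simpa [hT, h4] using hv
    · simp [hT, h4]
      field_simp
      ring
  have hu2 : sympForm u (T (T u)) = 0 := by
    have := sympForm_swap u (T (T u))
    simp only [hT, neg_neg] at this
    linear_combination this / 2
  refine ⟨_, ![-T (T (T u)), -T (T u), -T u, u], isSympFrame_mk hu ?_ ?_ ?_ ?_ ?_ ?_, ?_⟩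
  all_goals simp [Fin.forall_fin_succ, Fin.sum_univ_four, Nrep, hT, h4, hu1, hu2]

theorem sq_eq_zero_of_cube_eq_zero
    (hT : ∀ x y, sympForm (T x) y = -sympForm x (T y)) (h3 : ∀ x, T (T (T x)) = 0)
    (v : Fin 4 → ℂ) : T (T v) = 0 := by
  by_contra hv
  obtain ⟨w, hw⟩ := exists_sympForm_ne_zero hv
  have hw' : sympForm v (T (T w)) ≠ 0 := by simpa [hT] using hw
  obtain ⟨z, hz, hvz⟩ : ∃ z, sympForm v (T (T z)) ≠ 0 ∧ sympForm v z = 0 := by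
    refine ⟨w - (sympForm v w / sympForm v (T (T w))) • T (T w), ?_, ?_⟩
    · simpa [h3] using hw'
    · simp
      field_simp
      ring
  have hdiag (x) : sympForm x (T (T x)) = 0 := by
    have := sympForm_swap x (T (T x))
    simp only [hT, neg_neg] at this
    linear_combination this / 2
  have hf : IsSympFrame (sympForm v (T (T z))) ![T (T v), v, T (T z), z] := by
    refine isSympFrame_mk hz ?_ ?_ ?_ ?_ ?_ ?_ <;> simp [hT, h3, hdiag, hvz]
  obtain ⟨a, ha⟩ := hf.exists_eq_sum (T v)
  simp only [Fin.sum_univ_four, Matrix.cons_val] at ha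
  have ha2 := congrArg (fun x => T (T x)) ha
  simp only [map_add, map_smul, h3, smul_zero, zero_add, add_zero] at ha2
  have ha1 : a 1 = 0 := by
    have := congrArg (fun x => sympForm x z) ha2
    simpa [hT, hdiag, hz] using this
  have ha3 : a 3 = 0 := by
    have := congrArg (sympForm v) ha2
    simpa [hT, hdiag, hz] using this
  have := congrArg T ha
  simp only [ha1, ha3, map_add, map_smul, h3, zero_smul, smul_zero, add_zero] at this
  exact hv this

theorem exists_frame_of_sq_eq_zero
    (hT : ∀ x y, sympForm (T x) y = -sympForm x (T y)) (h2 : ∀ x, T (T x) = 0)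
    (h1 : ∃ x, T x ≠ 0) :
    ∃ c h, IsSympFrame c h ∧
      ((∀ j, T (h j) = ∑ i, Nrep 0 i j • h i) ∨ ∀ j, T (h j) = ∑ i, Nrep 1 i j • h i) := by
  have hsymm (x y) : sympForm x (T y) = sympForm y (T x) := by
    rw [sympForm_swap x, hT, neg_neg]
  obtain ⟨x, hx⟩ := h1
  obtain ⟨y, hy⟩ := exists_sympForm_ne_zero hx
  obtain ⟨v, -, hv⟩ := exists_diag_ne_zero (S := Set.univ) (by simp) hsymm
    (Set.mem_univ y) (Set.mem_univ x) (by rw [sympForm_swap]; simpa using hy)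
  have hproj (x) : ∃ (p : Fin 4 → ℂ) (s t : ℂ), x = p + s • v + t • T v ∧ sympForm v p = 0 ∧
      sympForm v (T p) = 0 := by
    refine ⟨x - (sympForm x (T v) / sympForm v (T v)) • v -
      (sympForm v x / sympForm v (T v)) • T v,
      sympForm x (T v) / sympForm v (T v), sympForm v x / sympForm v (T v), by abel, ?_, ?_⟩
    · simp [sympForm_self, hv]
    · simp [h2, hsymm v x, hv]
  by_cases hP : ∀ p, sympForm v p = 0 → sympForm v (T p) = 0 → T p = 0
  · obtain ⟨p, hp, hp', hp0⟩ : ∃ p, sympForm v p = 0 ∧ sympForm v (T p) = 0 ∧ p ≠ 0 := by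
      by_contra! h
      have hspan : Submodule.span ℂ (Set.range ![v, T v]) = ⊤ := by
        rw [eq_top_iff]
        rintro x -
        obtain ⟨p, s, t, rfl, hp, hp'⟩ := hproj x
        rw [h p hp hp', zero_add]
        exact add_mem (Submodule.smul_mem _ _ (Submodule.subset_span ⟨0, rfl⟩))
          (Submodule.smul_mem _ _ (Submodule.subset_span ⟨1, rfl⟩))
      have := finrank_range_le_card (R := ℂ) ![v, T v]
      rw [Set.finrank, hspan, finrank_top] at this
      simp at this
    obtain ⟨x, hx⟩ := exists_sympForm_ne_zero hp0
    obtain ⟨q, s, t, rfl, hq, hq'⟩ := hproj x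
    have hpq : sympForm p q ≠ 0 := by
      simpa [sympForm_swap p v, hp, hsymm p v, hp'] using hx
    refine ⟨-sympForm v (T v), ![p, T v, v, -(sympForm v (T v) / sympForm p q) • q],
      isSympFrame_mk (neg_ne_zero.2 hv) ?_ ?_ ?_ ?_ ?_ ?_, Or.inl ?_⟩
    all_goals simp [Fin.forall_fin_succ, Fin.sum_univ_four, Nrep, hT, h2, hP p hp hp',
      hP q hq hq', hp, hq, hsymm p v, sympForm_swap p v, hpq]
  · push Not at hP
    obtain ⟨p, hp, hp', hp0⟩ := hP
    obtain ⟨x, hx⟩ := exists_sympForm_ne_zero hp0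
    obtain ⟨q, s, t, rfl, hq, hq'⟩ := hproj x
    have hpq : sympForm p (T q) ≠ 0 := by
      simpa [hT, h2, hsymm p v, hp'] using hx
    obtain ⟨w, ⟨hw, hw'⟩, hw0⟩ :=
      exists_diag_ne_zero (S := {x | sympForm v x = 0 ∧ sympForm v (T x) = 0})
        (fun x hx y hy => by simp [hx.1, hx.2, hy.1, hy.2]) hsymm ⟨hp, hp'⟩ ⟨hq, hq'⟩ hpq
    obtain ⟨r, hr⟩ := IsAlgClosed.exists_eq_mul_self (-(sympForm v (T v) / sympForm w (T w)))
    have hrw : r * (r * sympForm w (T w)) = -sympForm v (T v) := by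
      rw [← mul_assoc, ← hr]
      field_simp
    refine ⟨-(2 * sympForm v (T v)),
      ![T v + r • T w, v + r • w, -T v + r • T w, v - r • w],
      isSympFrame_mk (by simpa using hv) ?_ ?_ ?_ ?_ ?_ ?_, Or.inr ?_⟩
    all_goals simp [Fin.forall_fin_succ, Fin.sum_univ_four, Nrep, hT, h2, hw, hw', hsymm w v,
      sympForm_swap w v, sympForm_self, hrw]
    all_goals ring

end Nilpotent

theorem toLin'_skew_of_mem_gsp {X : Matrix (Fin 4) (Fin 4) ℂ}
    (hX : ∃ μ : ℂ, Xᵀ * J4 + J4 * X = μ • J4) (hnil : IsNilpotent X) (x y : Fin 4 → ℂ) :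
    sympForm (Matrix.toLin' X x) y = -sympForm x (Matrix.toLin' X y) := by
  obtain ⟨μ, hμ⟩ := hX
  have htr : X.trace = 0 := (Matrix.isNilpotent_trace_of_isNilpotent hnil).eq_zero
  have hμ0 : μ = 0 := by
    have e1 := congrFun (congrFun hμ 0) 3
    have e2 := congrFun (congrFun hμ 1) 2
    simp only [Matrix.add_apply, Matrix.mul_apply, Fin.sum_univ_four] at e1 e2
    simp [J4] at e1 e2
    simp [Matrix.trace, Fin.sum_univ_four] at htr
    linear_combination (htr - e1 - e2) / 2
  rw [hμ0, zero_smul] at hμ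
  have h1 : Xᵀ * J4 = -(J4 * X) := eq_neg_of_add_eq_zero_left hμ
  simp only [sympForm, Matrix.toBilin'_apply', Matrix.toLin'_apply]
  rw [← Matrix.vecMul_transpose, ← Matrix.dotProduct_mulVec, Matrix.mulVec_mulVec, h1,
    Matrix.neg_mulVec, dotProduct_neg, Matrix.mulVec_mulVec]

theorem pow_four_eq_zero {X : Matrix (Fin 4) (Fin 4) ℂ} (hnil : IsNilpotent X) : X ^ 4 = 0 := by
  have h := (Matrix.isNilpotent_charpoly_sub_pow_of_isNilpotent hnil).eq_zero
  have h' := X.aeval_self_charpoly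
  rw [sub_eq_zero.1 h] at h'
  simpa using h'

/-- The representatives are pairwise non-conjugate, already under `GL (Fin 4) ℂ`. -/
theorem Nrep_not_conj {i j : Fin 3} (hij : i < j) {g : Matrix (Fin 4) (Fin 4) ℂ}
    (hg : IsUnit g) : g * Nrep i ≠ Nrep j * g := by
  intro h
  by_cases hj : j = 2
  · have h2 : Nrep i * Nrep i = 0 := by
      subst hj
      fin_cases i <;> simp [Nrep] at hij ⊢ <;> ext a b <;> fin_cases a <;> fin_cases b <;> simp
    have : Nrep j * Nrep j * g = 0 := by
      rw [mul_assoc, ← h, ← mul_assoc, ← h, mul_assoc, h2, mul_zero]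
    rw [hg.mul_left_eq_zero] at this
    have := congrFun (congrFun this 0) 2
    simp [hj, Nrep, Matrix.mul_apply, Fin.sum_univ_four] at this
  · obtain ⟨rfl, rfl⟩ : i = 0 ∧ j = 1 := by omega
    have e (a b) := congrFun (congrFun h a) b
    have e00 := e 0 0
    have e01 := e 0 1
    have e03 := e 0 3
    have e20 := e 2 0
    have e21 := e 2 1
    have e23 := e 2 3
    simp [Nrep, Matrix.mul_apply, Fin.sum_univ_four, eq_comm (a := (0 : ℂ))]
      at e00 e01 e03 e20 e21 e23
    have hdet : g.det = 0 := by
      simp [Matrix.det_succ_row_zero, Fin.sum_univ_succ, Fin.succAbove, e00, e01, e03, e20, e21,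
        e23]
    rw [Matrix.isUnit_iff_isUnit_det, hdet] at hg
    exact not_isUnit_zero hg

/-- Every nonzero nilpotent element `X` of `gsp₄(ℂ)` is `GSp₄(ℂ)`-conjugate to exactly one
of `𝒩₁`, `𝒩₂`, `𝒩₃`: there are `g ∈ GL₄(ℂ)` with `gᵀJg = cJ` (`c ≠ 0`) and a unique index
`i` such that `g X g⁻¹ = 𝒩ᵢ`. -/
theorem nilpotent_gsp4_classification (X : Matrix (Fin 4) (Fin 4) ℂ)
    (hX : ∃ μ : ℂ, Xᵀ * J4 + J4 * X = μ • J4)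
    (hnil : IsNilpotent X) (h0 : X ≠ 0) :
    ∃! i : Fin 3, ∃ (g : GL (Fin 4) ℂ) (c : ℂˣ),
      (g : Matrix (Fin 4) (Fin 4) ℂ)ᵀ * J4 * (g : Matrix (Fin 4) (Fin 4) ℂ) = (c : ℂ) • J4 ∧
      (g : Matrix (Fin 4) (Fin 4) ℂ) * X * (↑g⁻¹ : Matrix (Fin 4) (Fin 4) ℂ) = Nrep i := by
  have hT := toLin'_skew_of_mem_gsp hX hnil
  have hex : ∃ i : Fin 3, ∃ (g : GL (Fin 4) ℂ) (c : ℂˣ),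
      (g : Matrix (Fin 4) (Fin 4) ℂ)ᵀ * J4 * (g : Matrix (Fin 4) (Fin 4) ℂ) = (c : ℂ) • J4 ∧
      (g : Matrix (Fin 4) (Fin 4) ℂ) * X * (↑g⁻¹ : Matrix (Fin 4) (Fin 4) ℂ) = Nrep i := by
    by_cases h3 : ∃ x, Matrix.toLin' X (Matrix.toLin' X (Matrix.toLin' X x)) ≠ 0
    · obtain ⟨c, h, hh, hN⟩ := exists_frame_of_cube_ne_zero hT (fun x => by
        have h4 := pow_four_eq_zero hnil
        simp only [pow_succ, pow_zero, one_mul] at h4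
        simp [← mul_assoc, h4]) h3
      exact ⟨2, hh.exists_conj hN⟩
    · push Not at h3
      have h1 : ∃ x, Matrix.toLin' X x ≠ 0 := by
        by_contra! h
        exact h0 (Matrix.toLin'.map_eq_zero_iff.1 (LinearMap.ext h))
      obtain ⟨c, h, hh, hN | hN⟩ :=
        exists_frame_of_sq_eq_zero hT (sq_eq_zero_of_cube_eq_zero hT h3) h1
      · exact ⟨0, hh.exists_conj hN⟩
      · exact ⟨1, hh.exists_conj hN⟩
  have key : ∀ (i j : Fin 3) (g k : GL (Fin 4) ℂ),
      (g : Matrix (Fin 4) (Fin 4) ℂ) * X * (↑g⁻¹ : Matrix (Fin 4) (Fin 4) ℂ) = Nrep i →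
      (k : Matrix (Fin 4) (Fin 4) ℂ) * X * (↑k⁻¹ : Matrix (Fin 4) (Fin 4) ℂ) = Nrep j →
      ¬ i < j := by
    intro i j g k hi hj hij
    refine Nrep_not_conj hij (k * g⁻¹).isUnit ?_
    rw [← hi, ← hj, Units.val_mul]
    simp only [mul_assoc, Units.inv_mul_cancel_left]
  obtain ⟨i, g, c, hg, hi⟩ := hex
  refine ⟨i, ⟨g, c, hg, hi⟩, ?_⟩
  rintro j ⟨k, d, -, hj⟩
  exact le_antisymm (not_lt.1 (key i j g k hi hj)) (not_lt.1 (key j i k g hj hi))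

end
end

section
/- Let k be an algebraically closed field of characteristic zero, G a group, and H a normal subgroup of G of prime index q. Let τ : H → GL(V) be an irreducible finite-dimensional k-linear representation that is G-invariant, i.e., for every g ∈ G the representation h ↦ τ(g h g⁻¹) is isomorphic to τ. Then τ admits an extension to a representation τ̃ : G → GL(V) with τ̃|_H = τ; moreover, the representations of G extending τ are precisely the q twists τ̃ ⊗ η, where η ranges over the characters of the cyclic group G/H, and these q extensions are pairwise non-isomorphic. -/
noncomputable section

section Extension

variable {G A : Type*} [Group G] [Group A] {H : Subgroup G} [H.Normal] {τ : H →* A}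

theorem semiconjBy_conjNormal_zpow {g : G} {T : A}
    (hT : ∀ h : H, SemiconjBy T (τ h) (τ (MulAut.conjNormal g h))) (n : ℤ) :
    ∀ h : H, SemiconjBy (T ^ n) (τ h) (τ (MulAut.conjNormal (g ^ n) h)) := by
  induction n with
  | zero => simp [SemiconjBy]
  | succ n ih =>
    intro h
    rw [zpow_add_one, zpow_add_one, map_mul, MulAut.mul_apply]
    exact (ih _).mul_left (hT h)
  | pred n ih =>
    intro h
    rw [zpow_sub_one, zpow_sub_one, map_mul, MulAut.mul_apply]
    refine (ih _).mul_left ?_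
    have := hT (MulAut.conjNormal g⁻¹ h)
    rw [← MulAut.mul_apply, ← map_mul, mul_inv_cancel, map_one, MulAut.one_apply] at this
    exact this.inv_symm_left

/-- A homomorphism `τ` on a normal subgroup of prime index `q` extends to the whole group once
some `g ∉ H` is assigned a value `T` that acts on `τ` by conjugation as `g` does and satisfies
`T ^ q = τ (g ^ q)`. -/
theorem exists_monoidHom_extension_of_prime_index {q : ℕ} (hq : q.Prime) (hindex : H.index = q)
    {g : G} (hg : g ∉ H) {T : A}
    (hT : ∀ h : H, SemiconjBy T (τ h) (τ (MulAut.conjNormal g h)))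
    (hgq : g ^ q ∈ H) (hTq : T ^ q = τ ⟨g ^ q, hgq⟩) :
    ∃ τ' : G →* A, ∀ h : H, τ' h = τ h := by
  have : Fact q.Prime := ⟨hq⟩
  have hcard : Nat.card (G ⧸ H) = q := hindex
  have hg1 : (g : G ⧸ H) ≠ 1 := by rwa [Ne, QuotientGroup.eq_one_iff]
  have hord : orderOf (g : G ⧸ H) = q :=
    orderOf_eq_prime (by rwa [← QuotientGroup.mk_pow, QuotientGroup.eq_one_iff]) hg1
  have hdecomp : ∀ x : G, ∃ (h : H) (n : ℤ), x = h * g ^ n := by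
    intro x
    obtain ⟨n, hn⟩ := Subgroup.mem_zpowers_iff.mp
      (mem_zpowers_of_prime_card hcard hg1 (g' := (x : G ⧸ H)))
    refine ⟨⟨x * (g ^ n)⁻¹, ?_⟩, n, by simp⟩
    rw [← QuotientGroup.eq_one_iff, QuotientGroup.mk_mul, QuotientGroup.mk_inv,
      QuotientGroup.mk_zpow, hn, mul_inv_cancel]
  have hwd : ∀ (h h' : H) (n n' : ℤ), (h : G) * g ^ n = h' * g ^ n' →
      τ h * T ^ n = τ h' * T ^ n' := by
    intro h h' n n' heq
    have hsub : g ^ (n - n') = ((h⁻¹ * h' : H) : G) := by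
      rw [zpow_sub, Subgroup.coe_mul, Subgroup.coe_inv, mul_inv_eq_iff_eq_mul, mul_assoc, ← heq,
        inv_mul_cancel_left]
    have hdvd : (q : ℤ) ∣ n - n' := by
      rw [← hord, orderOf_dvd_iff_zpow_eq_one, ← QuotientGroup.mk_zpow, hsub,
        QuotientGroup.eq_one_iff]
      exact SetLike.coe_mem _
    obtain ⟨m, hm⟩ := hdvd
    have hTsub : T ^ (n - n') = τ (h⁻¹ * h') := by
      rw [hm, zpow_mul, zpow_natCast, hTq, ← map_zpow]
      congr 1
      ext
      rw [← hsub, hm, zpow_mul, zpow_natCast, Subgroup.coe_zpow]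
    rw [zpow_sub, mul_inv_eq_iff_eq_mul, map_mul, map_inv, mul_assoc] at hTsub
    rw [hTsub, mul_inv_cancel_left]
  choose a n han using hdecomp
  refine ⟨MonoidHom.mk' (fun x ↦ τ (a x) * T ^ n x) fun x y ↦ ?_, fun h ↦ ?_⟩
  · have key : τ (a x) * T ^ n x * (τ (a y) * T ^ n y) =
        τ (a x * MulAut.conjNormal (g ^ n x) (a y)) * T ^ (n x + n y) := by
      rw [map_mul, zpow_add, mul_assoc, ← mul_assoc (T ^ n x),
        (semiconjBy_conjNormal_zpow hT (n x) (a y)).eq]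
      simp only [mul_assoc]
    rw [key]
    apply hwd
    rw [← han, Subgroup.coe_mul, MulAut.conjNormal_apply, zpow_add]
    conv_lhs => rw [han x, han y]
    group
  · simpa using hwd (a h) h (n h) 0 (by rw [← han, zpow_zero, mul_one])

theorem natCard_monoidHom_units_trivial_on {k : Type*} [Field k] [IsAlgClosed k] [CharZero k]
    {q : ℕ} (hq : q.Prime) (hindex : H.index = q) :
    Nat.card {η : G →* kˣ // ∀ h ∈ H, η h = 1} = q := by
  have : Fact q.Prime := ⟨hq⟩
  have hcard : Nat.card (G ⧸ H) = q := hindex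
  have : IsCyclic (G ⧸ H) := isCyclic_of_prime_card hcard
  have : Finite (G ⧸ H) := Nat.finite_of_card_ne_zero (hcard ▸ hq.ne_zero)
  let _ : CommGroup (G ⧸ H) := IsCyclic.commGroup
  have : NeZero (Monoid.exponent (G ⧸ H)) := ⟨Monoid.exponent_ne_zero_of_finite⟩
  have : NeZero ((Monoid.exponent (G ⧸ H) : ℕ) : k) := NeZero.charZero
  let e : {η : G →* kˣ // ∀ h ∈ H, η h = 1} ≃ (G ⧸ H →* kˣ) :=
    { toFun η := QuotientGroup.lift H η.1 η.2
      invFun χ := ⟨χ.comp (QuotientGroup.mk' H), fun h hh ↦ by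
        simp [(QuotientGroup.eq_one_iff h).mpr hh]⟩
      left_inv η := by ext; rfl
      right_inv χ := by ext; rfl }
  rw [Nat.card_congr e, CommGroup.card_monoidHom_of_hasEnoughRootsOfUnity, hcard]

end Extension

section Schur

open LinearMap (GeneralLinearGroup)

variable {k V : Type*} [Field k] [AddCommGroup V] [Module k V]

/-- The homomorphism sending a scalar to the corresponding homothety. -/
def scalarGL (k V : Type*) [Field k] [AddCommGroup V] [Module k V] :
    kˣ →* GeneralLinearGroup k V :=
  Units.map (algebraMap k (Module.End k V)).toMonoidHom

theorem coe_scalarGL_mul (c : kˣ) (A : GeneralLinearGroup k V) :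
    ((scalarGL k V c * A : GeneralLinearGroup k V) : V →ₗ[k] V) =
      (c : k) • (A : V →ₗ[k] V) :=
  (Algebra.smul_def (c : k) (A : Module.End k V)).symm

theorem scalarGL_injective [Nontrivial V] : Function.Injective (scalarGL k V) :=
  Units.map_injective (algebraMap k (Module.End k V)).injective

theorem scalarGL_commute (c : kˣ) (A : GeneralLinearGroup k V) : Commute (scalarGL k V c) A :=
  Units.ext (Algebra.commutes (c : k) (A : Module.End k V))

variable [IsAlgClosed k] [FiniteDimensional k V] [Nontrivial V]

/-- Schur's lemma for invertible endomorphisms. -/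
theorem exists_eq_scalarGL_of_commute {ι : Type*} {τ : ι → GeneralLinearGroup k V}
    (hirr : ∀ W : Submodule k V, (∀ i, W.map (τ i : V →ₗ[k] V) ≤ W) → W = ⊥ ∨ W = ⊤)
    {A : GeneralLinearGroup k V} (hA : ∀ i, Commute A (τ i)) :
    ∃ c : kˣ, A = scalarGL k V c := by
  obtain ⟨μ, hμ⟩ := Module.End.exists_eigenvalue (A : Module.End k V)
  have hcomm (i : ι) (v : V) : (A : Module.End k V) ((τ i : Module.End k V) v) =
      (τ i : Module.End k V) ((A : Module.End k V) v) :=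
    LinearMap.congr_fun (congrArg Units.val (hA i).eq) v
  have htop := (hirr (Module.End.eigenspace (A : Module.End k V) μ) fun i ↦ by
    rintro _ ⟨v, hv, rfl⟩
    have hv' := Module.End.mem_eigenspace_iff.mp hv
    rw [Module.End.mem_eigenspace_iff, hcomm, hv', map_smul]).resolve_left hμ
  have hsmul (v : V) : (A : Module.End k V) v = μ • v :=
    Module.End.mem_eigenspace_iff.mp (htop ▸ Submodule.mem_top)
  have hμ0 : μ ≠ 0 := by
    rintro rfl
    obtain ⟨v, hv⟩ := exists_ne (0 : V)
    refine hv ?_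
    have hv' : ((A⁻¹ : GeneralLinearGroup k V) : Module.End k V) ((A : Module.End k V) v) = v :=
      LinearMap.congr_fun A.inv_mul v
    rw [← hv', hsmul, zero_smul, map_zero]
  exact ⟨Units.mk0 μ hμ0, Units.ext (LinearMap.ext hsmul)⟩

end Schur

/-- **Extension of invariant irreducible representations across prime index.**
Let `k` be an algebraically closed field of characteristic zero, `G` a group, `H ⊴ G` of
prime index `q`, and `τ` an irreducible finite-dimensional `G`-invariant representation of
`H` on `V`.  Then `τ` extends to `G`; the extensions are precisely the twists of a fixed
extension by the `q` characters of `G/H` (i.e. characters of `G` trivial on `H`), and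
distinct twists are non-isomorphic. -/
theorem extend_invariant_irreducible_prime_index
    (k : Type*) [Field k] [IsAlgClosed k] [CharZero k]
    (G : Type*) [Group G] (H : Subgroup G) [H.Normal]
    (q : ℕ) (hq : q.Prime) (hindex : H.index = q)
    (V : Type*) [AddCommGroup V] [Module k V] [FiniteDimensional k V] [Nontrivial V]
    (τ : ↥H →* LinearMap.GeneralLinearGroup k V)
    -- `τ` is irreducible
    (hirr : ∀ W : Submodule k V,
      (∀ h : ↥H, W.map (τ h : V →ₗ[k] V) ≤ W) → W = ⊥ ∨ W = ⊤)
    -- `τ` is `G`-invariant: `τ^g ≅ τ` for every `g ∈ G`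
    (hinv : ∀ g : G, ∃ e : LinearMap.GeneralLinearGroup k V,
      ∀ (h : G) (hh : h ∈ H) (hh' : g * h * g⁻¹ ∈ H),
        τ ⟨g * h * g⁻¹, hh'⟩ = e * τ ⟨h, hh⟩ * e⁻¹) :
    ∃ τ' : G →* LinearMap.GeneralLinearGroup k V,
      -- `τ'` extends `τ`
      (∀ h : ↥H, τ' ↑h = τ h) ∧
      -- the extensions of `τ` are precisely the twists of `τ'` by characters of `G/H`
      (∀ σ : G →* LinearMap.GeneralLinearGroup k V,
        (∀ h : ↥H, σ ↑h = τ h) ↔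
          ∃ η : G →* kˣ, (∀ h ∈ H, η h = 1) ∧
            ∀ g : G, (σ g : V →ₗ[k] V) = (η g : k) • (τ' g : V →ₗ[k] V)) ∧
      -- there are exactly `q` such characters, hence `q` extensions
      Nat.card {η : G →* kˣ // ∀ h ∈ H, η h = 1} = q ∧
      -- and the twists by distinct characters are pairwise non-isomorphic
      (∀ η η' : G →* kˣ, (∀ h ∈ H, η h = 1) → (∀ h ∈ H, η' h = 1) →
        (∃ e : LinearMap.GeneralLinearGroup k V, ∀ g : G,
          (η g : k) • (τ' g : V →ₗ[k] V) =
            (e : V →ₗ[k] V) * ((η' g : k) • (τ' g : V →ₗ[k] V)) * (↑e⁻¹ : V →ₗ[k] V)) →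
        η = η') := by
  have hsc {A B : LinearMap.GeneralLinearGroup k V} {φ : H → H}
      (hA : ∀ h, SemiconjBy A (τ h) (τ (φ h))) (hB : ∀ h, SemiconjBy B (τ h) (τ (φ h))) :
      ∃ c : kˣ, A = B * scalarGL k V c := by
    obtain ⟨c, hc⟩ := exists_eq_scalarGL_of_commute hirr (A := B⁻¹ * A)
      fun h ↦ (hB h).inv_symm_left.mul_left (hA h)
    exact ⟨c, by rw [← hc, mul_inv_cancel_left]⟩
  have hconj {σ : G →* LinearMap.GeneralLinearGroup k V} (hσ : ∀ h : H, σ h = τ h) (g : G)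
      (h : H) : SemiconjBy (σ g) (τ h) (τ (MulAut.conjNormal g h)) := by
    rw [← hσ, ← hσ, MulAut.conjNormal_apply, SemiconjBy, ← map_mul, ← map_mul,
      inv_mul_cancel_right]
  obtain ⟨τ', hτ'⟩ : ∃ τ' : G →* LinearMap.GeneralLinearGroup k V, ∀ h : H, τ' h = τ h := by
    obtain ⟨g, hg⟩ : ∃ g, g ∉ H := by
      by_contra! hall
      rw [(Subgroup.eq_top_iff' H).mpr hall, Subgroup.index_top] at hindex
      exact hq.ne_one hindex.symm
    have hgq : g ^ q ∈ H := hindex ▸ H.pow_index_mem g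
    obtain ⟨e, he⟩ := hinv g
    have heconj (h : H) : SemiconjBy e (τ h) (τ (MulAut.conjNormal g h)) := by
      have := he h h.2 (MulAut.conjNormal g h).2
      exact (mul_inv_eq_iff_eq_mul.mp this.symm)
    obtain ⟨c, hc⟩ := hsc (A := e ^ q) (B := τ ⟨g ^ q, hgq⟩)
      (fun h ↦ zpow_natCast e q ▸ semiconjBy_conjNormal_zpow heconj q h) fun h ↦ by
        rw [SemiconjBy, ← map_mul, ← map_mul]
        congr 1
        ext
        rw [Subgroup.coe_mul, Subgroup.coe_mul, MulAut.conjNormal_apply, zpow_natCast,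
          inv_mul_cancel_right]
    obtain ⟨d, hd⟩ := IsAlgClosed.exists_pow_nat_eq (c : k) hq.pos
    have hd0 : d ≠ 0 := by
      rintro rfl
      exact c.ne_zero (by rw [← hd, zero_pow hq.ne_zero])
    have hdc : Units.mk0 d hd0 ^ q = c := Units.ext hd
    refine exists_monoidHom_extension_of_prime_index hq hindex hg
      (T := e * (scalarGL k V (Units.mk0 d hd0))⁻¹) (fun h ↦ (heconj h).mul_left ?_) hgq ?_
    · exact (scalarGL_commute _ (τ h)).inv_left
    · rw [((scalarGL_commute _ e).inv_left.symm).mul_pow, hc, inv_pow, ← map_pow, hdc,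
        mul_inv_cancel_right]
  refine ⟨τ', hτ', fun σ ↦ ⟨fun hσ ↦ ?_, ?_⟩, natCard_monoidHom_units_trivial_on hq hindex, ?_⟩
  · choose c hc using fun g ↦ hsc (hconj hσ g) (hconj hτ' g)
    refine ⟨MonoidHom.mk' c fun x y ↦ scalarGL_injective (k := k) (V := V) ?_, fun h hh ↦ ?_,
      fun g ↦ ?_⟩
    · have hxy := hc (x * y)
      rw [map_mul, hc x, hc y, map_mul, mul_assoc, ← mul_assoc (scalarGL k V (c x)),
        (scalarGL_commute (c x) (τ' y)).eq, mul_assoc (τ' x)] at hxy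
      rw [map_mul]
      simpa only [mul_assoc, mul_right_inj] using hxy.symm
    · refine scalarGL_injective (k := k) (V := V) ?_
      have hch := hc h
      rw [hσ ⟨h, hh⟩, hτ' ⟨h, hh⟩, left_eq_mul] at hch
      rw [map_one, MonoidHom.mk'_apply, hch]
    · rw [MonoidHom.mk'_apply, ← coe_scalarGL_mul, (scalarGL_commute (c g) (τ' g)).eq, ← hc]
  · rintro ⟨η, hη, hση⟩ h
    refine Units.ext ?_
    have := hση h
    rwa [hη h h.2, Units.val_one, one_smul, hτ'] at this
  · rintro η η' hη hη' ⟨e, he⟩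
    have he' (g : G) : scalarGL k V (η g) * τ' g = e * (scalarGL k V (η' g) * τ' g) * e⁻¹ :=
      Units.ext (by
        rw [Units.val_mul, Units.val_mul, Units.val_mul e, coe_scalarGL_mul]
        exact (coe_scalarGL_mul _ _).trans (he g))
    obtain ⟨c, rfl⟩ := exists_eq_scalarGL_of_commute hirr (A := e) fun h ↦ by
      have := he' h
      rw [hη h h.2, hη' h h.2, map_one, one_mul, hτ'] at this
      exact (eq_mul_inv_iff_mul_eq.mp this).symm
    ext1 g
    apply scalarGL_injective (k := k) (V := V)
    have := he' g
    rwa [(scalarGL_commute c _).eq, mul_inv_cancel_right, mul_left_inj] at this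

end
end
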